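/- arXiv:2505.01041 — 6 statements merged into one kernel-verified Lean document; each statement's English description precedes it below -/
import Mathlib

section
/- Let K be stabilizing. Then J(K) ≥ σ_min(D_0) · σ_min(R) · ‖K‖², where ‖K‖ is the spectral norm of K. -/
open Matrix

/-- Spectral radius of a real square matrix: the largest modulus of a complex eigenvalue. -/
noncomputable def specRad {n : ℕ} (M : Matrix (Fin n) (Fin n) ℝ) : ℝ :=
  sSup ((fun z : ℂ => ‖z‖) '' spectrum ℂ (M.map Complex.ofReal))

/-- Spectral (ℓ2-operator) norm of a real matrix. -/
noncomputable def spNorm {m n : ℕ} (M : Matrix (Fin m) (Fin n) ℝ) : ℝ :=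
  ‖LinearMap.toContinuousLinearMap (Matrix.toEuclideanLin M)‖

/-- Smallest singular value of a real square matrix: `√(λ_min(Mᵀ M))`. -/
noncomputable def sigmaMin {n : ℕ} (M : Matrix (Fin n) (Fin n) ℝ) : ℝ :=
  Real.sqrt (sInf (spectrum ℝ (Mᵀ * M)))

lemma trace_mul_nonneg_aux {n : ℕ} {M N : Matrix (Fin n) (Fin n) ℝ} (hM : M.PosSemidef)
    (hN : N.PosSemidef) : 0 ≤ (M * N).trace := by
  obtain ⟨m, v, rfl⟩ := Matrix.posSemidef_iff_eq_sum_vecMulVec.mp hM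
  rw [Finset.sum_mul, Matrix.trace_sum]
  refine Finset.sum_nonneg fun i _ => ?_
  rw [Matrix.trace_mul_comm, Matrix.mul_vecMulVec, Matrix.trace_vecMulVec, dotProduct_comm]
  exact hN.dotProduct_mulVec_nonneg (v i)

lemma sub_sigmaMin_aux {n : ℕ} {M : Matrix (Fin n) (Fin n) ℝ} (hM : M.PosDef) :
    (M - sigmaMin M • (1 : Matrix (Fin n) (Fin n) ℝ)).PosSemidef := by
  rw [Matrix.posSemidef_iff_isHermitian_and_spectrum_nonneg]
  refine ⟨?_, ?_⟩
  · refine hM.isHermitian.sub ?_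
    simp [Matrix.IsHermitian]
  · intro x hx
    have hx' : x + sigmaMin M ∈ spectrum ℝ M := by
      rw [← Algebra.algebraMap_eq_smul_one] at hx
      have := (spectrum.add_mem_add_iff (s := sigmaMin M)).2 hx
      simpa using this
    have hpos : 0 ≤ x + sigmaMin M :=
      (Matrix.posSemidef_iff_isHermitian_and_spectrum_nonneg.1 hM.posSemidef).2 hx'
    have hT : Mᵀ = M := by simpa [Matrix.IsHermitian] using hM.isHermitian
    have h2 : (x + sigmaMin M) ^ 2 ∈ spectrum ℝ (Mᵀ * M) := by
      rw [hT, ← pow_two]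
      exact spectrum.pow_mem_pow M 2 hx'
    have hbdd : BddBelow (spectrum ℝ (Mᵀ * M)) := by
      refine ⟨0, fun y hy => ?_⟩
      have := Matrix.posSemidef_conjTranspose_mul_self M
      rw [Matrix.conjTranspose_eq_transpose_of_trivial] at this
      exact (Matrix.posSemidef_iff_isHermitian_and_spectrum_nonneg.1 this).2 hy
    have h3 : sigmaMin M ≤ x + sigmaMin M := by
      conv_lhs => unfold sigmaMin
      rw [Real.sqrt_le_left hpos]
      exact csInf_le hbdd h2
    show 0 ≤ x
    linarith

lemma spNorm_sq_le_aux {m n : ℕ} (K : Matrix (Fin m) (Fin n) ℝ) :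
    spNorm K ^ 2 ≤ (K * Kᵀ).trace := by
  have htr : (K * Kᵀ).trace = ∑ i, ∑ j, K i j ^ 2 := by
    simp [Matrix.trace, Matrix.mul_apply, pow_two]
  have h0 : 0 ≤ ∑ i, ∑ j, K i j ^ 2 := by positivity
  rw [htr, ← Real.sq_sqrt h0]
  refine pow_le_pow_left₀ (norm_nonneg _) ?_ 2
  refine ContinuousLinearMap.opNorm_le_bound _ (Real.sqrt_nonneg _) fun x => ?_
  rw [EuclideanSpace.norm_eq, EuclideanSpace.norm_eq, ← Real.sqrt_mul h0]
  apply Real.sqrt_le_sqrt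
  rw [Finset.sum_mul]
  refine Finset.sum_le_sum fun i _ => ?_
  simp only [Real.norm_eq_abs, sq_abs]
  exact Finset.sum_mul_sq_le_sq_mul_sq Finset.univ (fun j => K i j) (fun j => x j)

/-- For a stabilizing gain `K`, `J(K) ≥ σ_min(D₀) σ_min(R) ‖K‖²`. -/
theorem cost_lower_bound_gain {d k : ℕ} (hd : 1 ≤ d) (hk : 1 ≤ k)
    (A : Matrix (Fin d) (Fin d) ℝ) (B : Matrix (Fin d) (Fin k) ℝ)
    (Q : Matrix (Fin d) (Fin d) ℝ) (R : Matrix (Fin k) (Fin k) ℝ)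
    (D0 : Matrix (Fin d) (Fin d) ℝ) (σ : ℝ) (hσ : 0 < σ)
    (hQ : Q.PosDef) (hR : R.PosDef) (hD0 : D0.PosDef)
    (K : Matrix (Fin k) (Fin d) ℝ) (hK : specRad (A - B * K) < 1)
    (DK : Matrix (Fin d) (Fin d) ℝ)
    (hDK : DK.PosDef)
    (hDKeq : DK = (D0 + σ ^ 2 • (B * Bᵀ)) + (A - B * K) * DK * (A - B * K)ᵀ) :
    sigmaMin D0 * sigmaMin R * spNorm K ^ 2
      ≤ ((Q + Kᵀ * R * K) * DK).trace + σ ^ 2 * R.trace := by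
  have hD : (DK - D0).PosSemidef := by
    have e : DK - D0 = σ ^ 2 • (B * Bᵀ) + (A - B * K) * DK * (A - B * K)ᵀ := by
      rw [sub_eq_iff_eq_add]
      refine hDKeq.trans ?_
      abel
    rw [e]
    have h1 := Matrix.posSemidef_self_mul_conjTranspose B
    have h2 := hDK.posSemidef.mul_mul_conjTranspose_same (A - B * K)
    rw [Matrix.conjTranspose_eq_transpose_of_trivial] at h1 h2
    exact (h1.smul (sq_nonneg σ)).add h2
  have hD' := hD.add (sub_sigmaMin_aux hD0)
  have hR' := sub_sigmaMin_aux hR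
  have hKRK : (Kᵀ * R * K).PosSemidef := by
    have := hR.posSemidef.conjTranspose_mul_mul_same K
    rwa [Matrix.conjTranspose_eq_transpose_of_trivial] at this
  have hKK : (K * Kᵀ).PosSemidef := by
    have := Matrix.posSemidef_self_mul_conjTranspose K
    rwa [Matrix.conjTranspose_eq_transpose_of_trivial] at this
  have t1 := trace_mul_nonneg_aux hQ.posSemidef hDK.posSemidef
  have t2 := trace_mul_nonneg_aux hKRK hD'
  have t3 := trace_mul_nonneg_aux hR' hKK
  have t4 : 0 ≤ σ ^ 2 * R.trace := mul_nonneg (sq_nonneg σ) hR.posSemidef.trace_nonneg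
  have t5 := spNorm_sq_le_aux K
  have s0 : 0 ≤ sigmaMin D0 := Real.sqrt_nonneg _
  have s1 : 0 ≤ sigmaMin R := Real.sqrt_nonneg _
  rw [sub_add_sub_cancel, Matrix.mul_sub, Matrix.trace_sub, Matrix.mul_smul, Matrix.trace_smul,
    Matrix.mul_one, smul_eq_mul] at t2
  rw [Matrix.sub_mul, Matrix.trace_sub, Matrix.smul_mul, Matrix.trace_smul,
    Matrix.one_mul, smul_eq_mul] at t3
  have e2 : (Kᵀ * R * K).trace = (R * (K * Kᵀ)).trace := by
    rw [Matrix.mul_assoc, Matrix.trace_mul_comm, Matrix.mul_assoc]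
  rw [e2] at t2
  rw [Matrix.add_mul, Matrix.trace_add]
  have a1 := mul_le_mul_of_nonneg_left t5 (mul_nonneg s0 s1)
  have a2 := mul_nonneg s0 t3
  linarith
end

section
/- Let K be stabilizing. Then J(K) ≥ σ_min(D_0) · σ_min(Q) / (1 − ρ(A − BK)²). -/
open Matrix

lemma aux_factor {n : ℕ} {M : Matrix (Fin n) (Fin n) ℝ} (h : M.PosSemidef) :
    ∃ C : Matrix (Fin n) (Fin n) ℝ, M = Cᵀ * C := by
  open scoped MatrixOrder in
  obtain ⟨C, hC⟩ := CStarAlgebra.nonneg_iff_eq_star_mul_self.mp h.nonneg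
  exact ⟨C, by simpa [star_eq_conjTranspose] using hC⟩

lemma aux_trace {n : ℕ} {M N : Matrix (Fin n) (Fin n) ℝ} (h : M.PosSemidef)
    (h' : N.PosSemidef) : 0 ≤ (M * N).trace := by
  obtain ⟨C, rfl⟩ := aux_factor h'
  rw [← Matrix.mul_assoc, Matrix.trace_mul_comm, ← Matrix.mul_assoc]
  have := (h.mul_mul_conjTranspose_same C).trace_nonneg
  simpa using this

lemma aux_le_trace {n : ℕ} {M : Matrix (Fin n) (Fin n) ℝ} (h : M.PosSemidef)
    (x : Fin n → ℝ) : x ⬝ᵥ M *ᵥ x ≤ M.trace * (x ⬝ᵥ x) := by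
  obtain ⟨C, rfl⟩ := aux_factor h
  rw [← Matrix.mulVec_mulVec, Matrix.dotProduct_mulVec, Matrix.vecMul_transpose,
    Matrix.trace_mul_comm]
  simp only [Matrix.trace, Matrix.diag, Matrix.mul_apply, dotProduct, mulVec, transpose_apply]
  rw [Finset.sum_mul]
  refine Finset.sum_le_sum fun i _ => ?_
  have := Finset.sum_mul_sq_le_sq_mul_sq Finset.univ (fun j => C i j) x
  simpa only [sq] using this

lemma aux_sigma {n : ℕ} {M : Matrix (Fin n) (Fin n) ℝ} (h : M.PosSemidef) :
    (M - sigmaMin M • (1 : Matrix (Fin n) (Fin n) ℝ)).PosSemidef := by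
  rw [posSemidef_iff_isHermitian_and_spectrum_nonneg] at h ⊢
  obtain ⟨hh, hs⟩ := h
  refine ⟨hh.sub ?_, fun μ hμ => ?_⟩
  · simp [IsHermitian]
  · have h1 : μ + sigmaMin M ∈ spectrum ℝ M := by
      rw [spectrum.add_mem_iff, Algebra.algebraMap_eq_smul_one]
      rwa [neg_add_eq_sub]
    have h2 : 0 ≤ μ + sigmaMin M := hs h1
    have h3 := spectrum.pow_mem_pow M 2 h1
    have h4 : sigmaMin M ≤ μ + sigmaMin M := by
      apply Real.sqrt_le_iff.mpr ⟨h2, ?_⟩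
      have : Mᵀ * M = M ^ 2 := by
        have : Mᵀ = M := by simpa [IsHermitian] using hh
        rw [this, sq]
      rw [this]
      exact csInf_le (Matrix.finite_spectrum _).bddBelow h3
    simpa using h4

lemma aux_quad {n : ℕ} {M : Matrix (Fin n) (Fin n) ℝ} (h : M.PosSemidef) (x : Fin n → ℝ) :
    sigmaMin M * (x ⬝ᵥ x) ≤ x ⬝ᵥ M *ᵥ x := by
  have := (aux_sigma h).dotProduct_mulVec_nonneg x
  simpa [sub_mulVec, smul_mulVec, dotProduct_sub] using this

lemma aux_eig {n : ℕ} (hn : 1 ≤ n) (L : Matrix (Fin n) (Fin n) ℝ) :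
    ∃ (a b : ℝ) (x y : Fin n → ℝ), 0 ≤ specRad L ∧ specRad L ^ 2 = a ^ 2 + b ^ 2 ∧
      0 < x ⬝ᵥ x + y ⬝ᵥ y ∧ L *ᵥ x = a • x - b • y ∧ L *ᵥ y = b • x + a • y := by
  have : Nonempty (Fin n) := ⟨⟨0, hn⟩⟩
  have hne := spectrum.nonempty_of_isAlgClosed_of_finiteDimensional ℂ (L.map Complex.ofReal)
  obtain ⟨z, hz, hzr⟩ := (hne.image (fun z : ℂ => ‖z‖)).csSup_mem
    ((Matrix.finite_spectrum (L.map Complex.ofReal)).image _)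
  change ‖z‖ = specRad L at hzr
  rw [← Matrix.spectrum_toLin', ← Module.End.hasEigenvalue_iff_mem_spectrum] at hz
  obtain ⟨v, hv⟩ := hz.exists_hasEigenvector
  have hv1 := hv.apply_eq_smul
  have hv0 := hv.2
  rw [Matrix.toLin'_apply] at hv1
  refine ⟨z.re, z.im, fun i => (v i).re, fun i => (v i).im, ?_, ?_, ?_, ?_, ?_⟩
  · rw [← hzr]; positivity
  · rw [← hzr, Complex.sq_norm, Complex.normSq_apply]; ring
  · obtain ⟨i, hi⟩ := Function.ne_iff.mp hv0
    simp only [dotProduct, ← Finset.sum_add_distrib]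
    refine Finset.sum_pos' (fun j _ => add_nonneg (mul_self_nonneg _) (mul_self_nonneg _)) ⟨i, Finset.mem_univ _, ?_⟩
    rw [← Complex.normSq_apply]
    exact Complex.normSq_pos.mpr hi
  · ext i
    have := congrArg Complex.re (congrFun hv1 i)
    simpa [mulVec, dotProduct] using this
  · ext i
    have := congrArg Complex.im (congrFun hv1 i)
    simp [mulVec, dotProduct] at this ⊢
    linarith


/-- For a stabilizing gain `K`, `J(K) ≥ σ_min(D₀) σ_min(Q) / (1 − ρ(A − BK)²)`. -/
theorem cost_lower_bound_specRad {d k : ℕ} (hd : 1 ≤ d) (hk : 1 ≤ k)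
    (A : Matrix (Fin d) (Fin d) ℝ) (B : Matrix (Fin d) (Fin k) ℝ)
    (Q : Matrix (Fin d) (Fin d) ℝ) (R : Matrix (Fin k) (Fin k) ℝ)
    (D0 : Matrix (Fin d) (Fin d) ℝ) (σ : ℝ) (hσ : 0 < σ)
    (hQ : Q.PosDef) (hR : R.PosDef) (hD0 : D0.PosDef)
    (K : Matrix (Fin k) (Fin d) ℝ) (hK : specRad (A - B * K) < 1)
    (PK : Matrix (Fin d) (Fin d) ℝ)
    (hPK : PK.PosDef)
    (hPKeq : PK = Q + Kᵀ * R * K + (A - B * K)ᵀ * PK * (A - B * K)) :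
    sigmaMin D0 * sigmaMin Q / (1 - specRad (A - B * K) ^ 2)
      ≤ (PK * (D0 + σ ^ 2 • (B * Bᵀ))).trace + σ ^ 2 * R.trace := by
  generalize hL : A - B * K = L at *
  obtain ⟨a, b, x, y, h0, hab, hpos, hx, hy⟩ := aux_eig hd L
  have hden : 0 < 1 - specRad L ^ 2 := by nlinarith
  have hq : ∀ u : Fin d → ℝ,
      sigmaMin Q * (u ⬝ᵥ u) + (L *ᵥ u) ⬝ᵥ PK *ᵥ (L *ᵥ u) ≤ u ⬝ᵥ PK *ᵥ u := by
    intro u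
    have e : u ⬝ᵥ PK *ᵥ u = u ⬝ᵥ Q *ᵥ u + (K *ᵥ u) ⬝ᵥ R *ᵥ (K *ᵥ u)
        + (L *ᵥ u) ⬝ᵥ PK *ᵥ (L *ᵥ u) := by
      conv_lhs => rw [hPKeq]
      simp only [add_mulVec, dotProduct_add, ← mulVec_mulVec]
      rw [dotProduct_mulVec u Kᵀ, dotProduct_mulVec u Lᵀ, vecMul_transpose, vecMul_transpose]
    have h1 := aux_quad hQ.posSemidef u
    have h2 : 0 ≤ (K *ᵥ u) ⬝ᵥ R *ᵥ (K *ᵥ u) := by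
      simpa using hR.posSemidef.dotProduct_mulVec_nonneg (K *ᵥ u)
    linarith
  have hqx := hq x
  have hqy := hq y
  have hsum : (L *ᵥ x) ⬝ᵥ PK *ᵥ (L *ᵥ x) + (L *ᵥ y) ⬝ᵥ PK *ᵥ (L *ᵥ y)
      = specRad L ^ 2 * (x ⬝ᵥ PK *ᵥ x + y ⬝ᵥ PK *ᵥ y) := by
    rw [hab, hx, hy]
    simp only [mulVec_add, mulVec_sub, mulVec_smul, dotProduct_add, dotProduct_sub,
      add_dotProduct, sub_dotProduct, smul_dotProduct, dotProduct_smul, smul_eq_mul]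
    ring
  have htx := aux_le_trace hPK.posSemidef x
  have hty := aux_le_trace hPK.posSemidef y
  have htr : sigmaMin Q ≤ (1 - specRad L ^ 2) * PK.trace := by
    have : sigmaMin Q * (x ⬝ᵥ x + y ⬝ᵥ y)
        ≤ ((1 - specRad L ^ 2) * PK.trace) * (x ⬝ᵥ x + y ⬝ᵥ y) := by
      have := mul_le_mul_of_nonneg_left (add_le_add htx hty) hden.le
      nlinarith
    exact le_of_mul_le_mul_right this hpos
  have hD : sigmaMin D0 * PK.trace ≤ (PK * D0).trace := by
    have := aux_trace hPK.posSemidef (aux_sigma hD0.posSemidef)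
    simpa [mul_sub, trace_sub] using this
  have hB : 0 ≤ (PK * (B * Bᵀ)).trace := by
    refine aux_trace hPK.posSemidef ?_
    simpa using posSemidef_self_mul_conjTranspose B
  have hRt : 0 ≤ R.trace := hR.posSemidef.trace_nonneg
  have hs : 0 ≤ sigmaMin D0 := Real.sqrt_nonneg _
  have hfin : sigmaMin D0 * sigmaMin Q / (1 - specRad L ^ 2) ≤ sigmaMin D0 * PK.trace := by
    rw [div_le_iff₀ hden]
    nlinarith [mul_le_mul_of_nonneg_left htr hs]
  have : (PK * (D0 + σ ^ 2 • (B * Bᵀ))).trace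
      = (PK * D0).trace + σ ^ 2 * (PK * (B * Bᵀ)).trace := by
    simp [mul_add, trace_add]
  rw [this]
  have := mul_nonneg (sq_nonneg σ) hB
  have := mul_nonneg (sq_nonneg σ) hRt
  linarith
end

section
/- (Lipschitz continuity of the critic target) Let K and K' be stabilizing, and for a stabilizing gain G define the block matrix Ω_G := [[Q + Aᵀ P_G A, Aᵀ P_G B], [Bᵀ P_G A, R + Bᵀ P_G B]] ∈ ℝ^{(d+k)×(d+k)}. Then ‖Ω_K − Ω_{K'}‖_F ≤ d^{3/2} (‖A‖ + ‖B‖)² ‖P_K − P_{K'}‖, where d := max(d, k). -/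
open Matrix

/-- Frobenius norm of a real matrix. -/
noncomputable def frobNorm {m n : Type*} [Fintype m] [Fintype n] (M : Matrix m n ℝ) : ℝ :=
  Real.sqrt (∑ i, ∑ j, (M i j) ^ 2)


open scoped Matrix.Norms.L2Operator in
lemma spNorm_eq_l2 {m n : ℕ} (M : Matrix (Fin m) (Fin n) ℝ) : spNorm M = ‖M‖ := by
  rw [Matrix.l2_opNorm_def]; rfl

lemma spNorm_nn {m n : ℕ} (M : Matrix (Fin m) (Fin n) ℝ) : 0 ≤ spNorm M := norm_nonneg _

open scoped Matrix.Norms.L2Operator in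
lemma spNorm_sandwich {d m n : ℕ} (M : Matrix (Fin d) (Fin m) ℝ) (X : Matrix (Fin d) (Fin d) ℝ)
    (N : Matrix (Fin d) (Fin n) ℝ) :
    spNorm (Mᵀ * X * N) ≤ spNorm M * spNorm X * spNorm N := by
  simp only [spNorm_eq_l2]
  refine (Matrix.l2_opNorm_mul _ _).trans ?_
  refine mul_le_mul_of_nonneg_right ?_ (norm_nonneg _)
  refine (Matrix.l2_opNorm_mul _ _).trans ?_
  rw [← Matrix.conjTranspose_eq_transpose_of_trivial, Matrix.l2_opNorm_conjTranspose]

lemma col_sq_le {m n : ℕ} (M : Matrix (Fin m) (Fin n) ℝ) (j : Fin n) :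
    ∑ i, (M i j) ^ 2 ≤ spNorm M ^ 2 := by
  have h := (LinearMap.toContinuousLinearMap (Matrix.toEuclideanLin M)).le_opNorm
    (EuclideanSpace.single j (1 : ℝ))
  have h2 : ‖(LinearMap.toContinuousLinearMap (Matrix.toEuclideanLin M))
    (EuclideanSpace.single j (1 : ℝ))‖ ≤ spNorm M := by simpa [spNorm] using h
  have h3 := pow_le_pow_left₀ (norm_nonneg _) h2 2
  rw [EuclideanSpace.norm_sq_eq] at h3
  simpa [Matrix.toEuclideanLin, Matrix.toLpLin_apply] using h3

lemma block_sq_le {d m n : ℕ} (hn : n ≤ d) (M : Matrix (Fin d) (Fin m) ℝ)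
    (X : Matrix (Fin d) (Fin d) ℝ) (N : Matrix (Fin d) (Fin n) ℝ) :
    ∑ i, ∑ j, ((Mᵀ * X * N) i j) ^ 2 ≤ d * (spNorm M * spNorm X * spNorm N) ^ 2 := by
  rw [Finset.sum_comm]
  have hs := pow_le_pow_left₀ (spNorm_nn _) (spNorm_sandwich M X N) 2
  calc ∑ j, ∑ i, ((Mᵀ * X * N) i j) ^ 2
      ≤ ∑ _j : Fin n, (spNorm M * spNorm X * spNorm N) ^ 2 :=
        Finset.sum_le_sum fun j _ => (col_sq_le _ j).trans hs
    _ = n * (spNorm M * spNorm X * spNorm N) ^ 2 := by simp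
    _ ≤ _ := by
        have : (n : ℝ) ≤ d := by exact_mod_cast hn
        gcongr

/-- Lipschitz continuity of the critic target: for stabilizing `K`, `K'`,
`‖Ω_K − Ω_{K'}‖_F ≤ (max d k)^{3/2} (‖A‖ + ‖B‖)² ‖P_K − P_{K'}‖`. -/
theorem critic_target_lipschitz {d k : ℕ} (hd : 1 ≤ d) (hk : 1 ≤ k) (hkd : k ≤ d)
    (A : Matrix (Fin d) (Fin d) ℝ) (B : Matrix (Fin d) (Fin k) ℝ)
    (Q : Matrix (Fin d) (Fin d) ℝ) (R : Matrix (Fin k) (Fin k) ℝ)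
    (D0 : Matrix (Fin d) (Fin d) ℝ) (σ : ℝ) (hσ : 0 < σ)
    (hQ : Q.PosDef) (hR : R.PosDef) (hD0 : D0.PosDef)
    (K K' : Matrix (Fin k) (Fin d) ℝ)
    (hK : specRad (A - B * K) < 1) (hK' : specRad (A - B * K') < 1)
    (PK PK' : Matrix (Fin d) (Fin d) ℝ)
    (hPK : PK.PosDef)
    (hPKeq : PK = Q + Kᵀ * R * K + (A - B * K)ᵀ * PK * (A - B * K))
    (hPK' : PK'.PosDef)
    (hPK'eq : PK' = Q + K'ᵀ * R * K' + (A - B * K')ᵀ * PK' * (A - B * K')) :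
    frobNorm
        (Matrix.fromBlocks (Q + Aᵀ * PK * A) (Aᵀ * PK * B) (Bᵀ * PK * A) (R + Bᵀ * PK * B) -
         Matrix.fromBlocks (Q + Aᵀ * PK' * A) (Aᵀ * PK' * B) (Bᵀ * PK' * A) (R + Bᵀ * PK' * B))
      ≤ ((max d k : ℕ) : ℝ) ^ ((3 : ℝ) / 2) * (spNorm A + spNorm B) ^ 2 * spNorm (PK - PK') := by
  have e : ∀ {m n : ℕ} (M : Matrix (Fin d) (Fin m) ℝ) (N : Matrix (Fin d) (Fin n) ℝ),
      Mᵀ * PK * N - Mᵀ * PK' * N = Mᵀ * (PK - PK') * N := by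
    intro m n M N
    rw [Matrix.mul_sub, Matrix.sub_mul]
  have hΔ : Matrix.fromBlocks (Q + Aᵀ * PK * A) (Aᵀ * PK * B) (Bᵀ * PK * A) (R + Bᵀ * PK * B) -
         Matrix.fromBlocks (Q + Aᵀ * PK' * A) (Aᵀ * PK' * B) (Bᵀ * PK' * A) (R + Bᵀ * PK' * B)
      = Matrix.fromBlocks (Aᵀ * (PK - PK') * A) (Aᵀ * (PK - PK') * B)
          (Bᵀ * (PK - PK') * A) (Bᵀ * (PK - PK') * B) := by
    rw [sub_eq_add_neg, Matrix.fromBlocks_neg, Matrix.fromBlocks_add]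
    simp only [← sub_eq_add_neg, add_sub_add_left_eq_sub, e]
  rw [hΔ, max_eq_left hkd]
  generalize PK - PK' = X
  have h1 := block_sq_le le_rfl A X A
  have h2 := block_sq_le hkd A X B
  have h3 := block_sq_le le_rfl B X A
  have h4 := block_sq_le hkd B X B
  have ha := spNorm_nn A
  have hb := spNorm_nn B
  have hx := spNorm_nn X
  have hd1 : (1 : ℝ) ≤ d := by exact_mod_cast hd
  unfold frobNorm
  apply Real.sqrt_le_iff.2
  refine ⟨by positivity, ?_⟩
  have hp : ((d : ℝ) ^ ((3 : ℝ) / 2)) ^ 2 = (d : ℝ) ^ 3 := by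
    rw [← Real.rpow_natCast, ← Real.rpow_mul (by positivity), ← Real.rpow_natCast]
    norm_num
  rw [mul_pow, mul_pow, hp]
  simp only [Fintype.sum_sum_type, Matrix.fromBlocks_apply₁₁, Matrix.fromBlocks_apply₁₂,
    Matrix.fromBlocks_apply₂₁, Matrix.fromBlocks_apply₂₂, Finset.sum_add_distrib]
  generalize spNorm A = a at *
  generalize spNorm B = b at *
  generalize spNorm X = x at *
  have hab : (a ^ 2 + b ^ 2) ≤ (a + b) ^ 2 := by nlinarith [mul_nonneg ha hb]
  calc _ ≤ (d : ℝ) * (a ^ 2 + b ^ 2) ^ 2 * x ^ 2 := by nlinarith [h1, h2, h3, h4]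
    _ ≤ (d : ℝ) ^ 3 * ((a + b) ^ 2) ^ 2 * x ^ 2 := by
      have : (d : ℝ) ≤ (d : ℝ) ^ 3 := le_self_pow₀ hd1 (by norm_num)
      gcongr
end

section
/- (Almost smoothness of LQR) Let K and K' both be stabilizing. Then J(K') − J(K) = −2 Tr(D_{K'} (K − K')ᵀ E_K) + Tr(D_{K'} (K − K')ᵀ (R + Bᵀ P_K B)(K − K')). -/
open Matrix

/-- Almost smoothness of LQR: for stabilizing `K`, `K'`,
`J(K') − J(K) = −2 Tr(D_{K'} (K−K')ᵀ E_K) + Tr(D_{K'} (K−K')ᵀ (R + Bᵀ P_K B)(K−K'))`. -/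
theorem almost_smoothness {d k : ℕ} (hd : 1 ≤ d) (hk : 1 ≤ k)
    (A : Matrix (Fin d) (Fin d) ℝ) (B : Matrix (Fin d) (Fin k) ℝ)
    (Q : Matrix (Fin d) (Fin d) ℝ) (R : Matrix (Fin k) (Fin k) ℝ)
    (D0 : Matrix (Fin d) (Fin d) ℝ) (σ : ℝ) (hσ : 0 < σ)
    (hQ : Q.PosDef) (hR : R.PosDef) (hD0 : D0.PosDef)
    (K K' : Matrix (Fin k) (Fin d) ℝ)
    (hK : specRad (A - B * K) < 1) (hK' : specRad (A - B * K') < 1)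
    (PK PK' DK' : Matrix (Fin d) (Fin d) ℝ)
    (hPK : PK.PosDef)
    (hPKeq : PK = Q + Kᵀ * R * K + (A - B * K)ᵀ * PK * (A - B * K))
    (hPK' : PK'.PosDef)
    (hPK'eq : PK' = Q + K'ᵀ * R * K' + (A - B * K')ᵀ * PK' * (A - B * K'))
    (hDK' : DK'.PosDef)
    (hDK'eq : DK' = (D0 + σ ^ 2 • (B * Bᵀ)) + (A - B * K') * DK' * (A - B * K')ᵀ) :
    ((PK' * (D0 + σ ^ 2 • (B * Bᵀ))).trace + σ ^ 2 * R.trace)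
      - ((PK * (D0 + σ ^ 2 • (B * Bᵀ))).trace + σ ^ 2 * R.trace)
      = -2 * (DK' * (K - K')ᵀ * ((R + Bᵀ * PK * B) * K - Bᵀ * PK * A)).trace
        + (DK' * (K - K')ᵀ * (R + Bᵀ * PK * B) * (K - K')).trace := by
  have hRt : Rᵀ = R := by simpa using hR.isHermitian.eq
  have hPt : PKᵀ = PK := by simpa using hPK.isHermitian.eq
  -- the one-step Lyapunov difference
  have h1 : (PK' - PK) - (A - B * K')ᵀ * (PK' - PK) * (A - B * K')
      = (Q + K'ᵀ * R * K') - (Q + Kᵀ * R * K + (A - B * K)ᵀ * PK * (A - B * K))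
        + (A - B * K')ᵀ * PK * (A - B * K') := by
    rw [← hPKeq, eq_sub_of_add_eq hPK'eq.symm]
    generalize A - B * K' = L
    rw [Matrix.mul_sub, Matrix.sub_mul]
    abel
  have h2 : (PK' - PK) - (A - B * K')ᵀ * (PK' - PK) * (A - B * K')
      = (K - K')ᵀ * (R + Bᵀ * PK * B) * (K - K')
        - (K - K')ᵀ * ((R + Bᵀ * PK * B) * K - Bᵀ * PK * A)
        - ((R + Bᵀ * PK * B) * K - Bᵀ * PK * A)ᵀ * (K - K') := by
    rw [h1]
    simp only [Matrix.transpose_sub, Matrix.transpose_add, Matrix.transpose_mul,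
      Matrix.transpose_transpose, hRt, hPt, Matrix.mul_add, Matrix.add_mul, Matrix.mul_sub,
      Matrix.sub_mul, Matrix.mul_assoc]
    abel
  generalize hE : (R + Bᵀ * PK * B) * K - Bᵀ * PK * A = E at h2 ⊢
  have hDt : DK'ᵀ = DK' := by simpa using hDK'.isHermitian.eq
  have h3 : (DK' * (Eᵀ * (K - K'))).trace = (DK' * ((K - K')ᵀ * E)).trace := by
    rw [← Matrix.trace_transpose, Matrix.transpose_mul, Matrix.transpose_mul,
      Matrix.transpose_transpose, hDt, Matrix.trace_mul_comm]
  have h4 : ((PK' - PK) * (D0 + σ ^ 2 • (B * Bᵀ))).trace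
      = (DK' * ((PK' - PK) - (A - B * K')ᵀ * (PK' - PK) * (A - B * K'))).trace := by
    rw [← sub_eq_of_eq_add hDK'eq]
    generalize PK' - PK = X
    generalize A - B * K' = L
    rw [Matrix.mul_sub, Matrix.mul_sub, Matrix.trace_sub, Matrix.trace_sub,
      Matrix.trace_mul_comm X DK']
    congr 1
    rw [← Matrix.mul_assoc, Matrix.trace_mul_comm, ← Matrix.mul_assoc, ← Matrix.mul_assoc,
      Matrix.trace_mul_comm, ← Matrix.mul_assoc]
  rw [h2, Matrix.mul_sub, Matrix.mul_sub, Matrix.trace_sub, Matrix.trace_sub, h3,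
    Matrix.sub_mul, Matrix.trace_sub] at h4
  simp only [Matrix.mul_assoc] at h4 ⊢
  linarith
end

section
/- (Gradient domination, upper bound) Let K be stabilizing and let K* be a stabilizing gain minimizing J over all stabilizing gains. Then J(K) − J(K*) ≤ (1 / σ_min(R)) · ‖D_{K*}‖ · Tr(E_Kᵀ E_K). -/
open Matrix

lemma aux_trace_mul_nonneg {n : ℕ} {X D : Matrix (Fin n) (Fin n) ℝ}
    (hX : X.PosSemidef) (hD : D.PosSemidef) : 0 ≤ (X * D).trace := by
  obtain ⟨C, rfl⟩ : ∃ C : Matrix (Fin n) (Fin n) ℝ, D = Cᴴ * C := by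
    open scoped MatrixOrder in
    exact CStarAlgebra.nonneg_iff_eq_star_mul_self.mp hD.nonneg
  have h := (hX.mul_mul_conjTranspose_same C).trace_nonneg
  rwa [← Matrix.mul_assoc, Matrix.trace_mul_comm, ← Matrix.mul_assoc]

lemma aux_conj {m n : ℕ} {X : Matrix (Fin n) (Fin n) ℝ}
    (hX : X.PosSemidef) (C : Matrix (Fin n) (Fin m) ℝ) : (Cᵀ * X * C).PosSemidef := by
  simpa [Matrix.conjTranspose_eq_transpose_of_trivial] using hX.conjTranspose_mul_mul_same C

lemma aux_sigmaMin {k : ℕ} (hk : 1 ≤ k) {R : Matrix (Fin k) (Fin k) ℝ} (hR : R.PosDef) :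
    0 < sigmaMin R ∧ (R - (sigmaMin R) • (1 : Matrix (Fin k) (Fin k) ℝ)).PosSemidef := by
  have hRt : Rᵀ = R := by
    simpa [Matrix.conjTranspose_eq_transpose_of_trivial] using hR.1.eq
  have hinj : Function.Injective R.mulVec :=
    Matrix.mulVec_injective_of_isUnit hR.isUnit
  have hRR : (Rᵀ * R).PosDef := by
    have := Matrix.PosDef.conjTranspose_mul_self R hinj
    simpa [Matrix.conjTranspose_eq_transpose_of_trivial] using this
  have hpos : ∀ x ∈ spectrum ℝ (Rᵀ * R), 0 < x := by
    intro x hx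
    rw [hRR.1.spectrum_real_eq_range_eigenvalues] at hx
    obtain ⟨i, rfl⟩ := hx
    exact hRR.eigenvalues_pos i
  have hne : (spectrum ℝ (Rᵀ * R)).Nonempty :=
    ⟨_, hRR.1.eigenvalues_mem_spectrum_real ⟨0, hk⟩⟩
  have hfin : (spectrum ℝ (Rᵀ * R)).Finite := Matrix.finite_spectrum _
  have hmem := hne.csInf_mem hfin
  refine ⟨Real.sqrt_pos.mpr (hpos _ hmem), ?_⟩
  rw [Matrix.posSemidef_iff_isHermitian_and_spectrum_nonneg]
  refine ⟨hR.1.sub (by simp [Matrix.IsHermitian, Matrix.conjTranspose_smul]), ?_⟩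
  intro x hx
  rw [← Algebra.algebraMap_eq_smul_one, ← spectrum.sub_singleton_eq] at hx
  obtain ⟨y, hy, z, hz, rfl⟩ := hx
  rw [Set.mem_singleton_iff] at hz
  subst hz
  have hy0 : 0 < y := by
    have hy' := hy
    rw [hR.1.spectrum_real_eq_range_eigenvalues] at hy'
    obtain ⟨i, rfl⟩ := hy'
    exact hR.eigenvalues_pos i
  have h2 : y ^ 2 ∈ spectrum ℝ (Rᵀ * R) := by
    rw [hRt, ← pow_two]
    exact spectrum.pow_mem_pow R 2 hy
  have h3 : sigmaMin R ≤ y := by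
    unfold sigmaMin
    exact Real.sqrt_le_iff.mpr ⟨hy0.le, csInf_le hfin.bddBelow h2⟩
  simpa using h3

lemma aux_spNorm {d : ℕ} {D : Matrix (Fin d) (Fin d) ℝ} (hD : D.PosDef) :
    ((spNorm D) • (1 : Matrix (Fin d) (Fin d) ℝ) - D).PosSemidef := by
  refine Matrix.PosSemidef.of_dotProduct_mulVec_nonneg
    (Matrix.IsHermitian.sub (by simp [Matrix.IsHermitian, Matrix.conjTranspose_smul]) hD.1) ?_
  intro x
  have h1 := real_inner_le_norm (WithLp.toLp 2 x : EuclideanSpace ℝ (Fin d))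
    (LinearMap.toContinuousLinearMap (Matrix.toEuclideanLin D) (WithLp.toLp 2 x))
  have h2 := (LinearMap.toContinuousLinearMap (Matrix.toEuclideanLin D)).le_opNorm
    (WithLp.toLp 2 x : EuclideanSpace ℝ (Fin d))
  have h3 : x ⬝ᵥ (D *ᵥ x) = inner ℝ (WithLp.toLp 2 x : EuclideanSpace ℝ (Fin d))
    (LinearMap.toContinuousLinearMap (Matrix.toEuclideanLin D) (WithLp.toLp 2 x)) := by
    rw [EuclideanSpace.inner_eq_star_dotProduct]
    simp [dotProduct_comm]
  have h4 : x ⬝ᵥ x = ‖(WithLp.toLp 2 x : EuclideanSpace ℝ (Fin d))‖ *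
      ‖(WithLp.toLp 2 x : EuclideanSpace ℝ (Fin d))‖ := by
    rw [← real_inner_self_eq_norm_mul_norm, EuclideanSpace.inner_eq_star_dotProduct]
    simp
  have h5 : star x ⬝ᵥ (((spNorm D) • (1 : Matrix (Fin d) (Fin d) ℝ) - D) *ᵥ x)
      = spNorm D * (x ⬝ᵥ x) - x ⬝ᵥ (D *ᵥ x) := by
    simp [Matrix.sub_mulVec, Matrix.smul_mulVec, dotProduct_sub]
  rw [h5, h3, h4]
  have h6 := mul_le_mul_of_nonneg_left h2
    (norm_nonneg (WithLp.toLp 2 x : EuclideanSpace ℝ (Fin d)))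
  unfold spNorm
  nlinarith

/-- Gradient domination (upper bound): for stabilizing `K` and an optimal stabilizing `K*`,
`J(K) − J(K*) ≤ σ_min(R)⁻¹ ‖D_{K*}‖ Tr(E_Kᵀ E_K)`. -/
theorem gradient_domination_upper {d k : ℕ} (hd : 1 ≤ d) (hk : 1 ≤ k)
    (A : Matrix (Fin d) (Fin d) ℝ) (B : Matrix (Fin d) (Fin k) ℝ)
    (Q : Matrix (Fin d) (Fin d) ℝ) (R : Matrix (Fin k) (Fin k) ℝ)
    (D0 : Matrix (Fin d) (Fin d) ℝ) (σ : ℝ) (hσ : 0 < σ)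
    (hQ : Q.PosDef) (hR : R.PosDef) (hD0 : D0.PosDef)
    (K Kstar : Matrix (Fin k) (Fin d) ℝ)
    (hK : specRad (A - B * K) < 1) (hKstar : specRad (A - B * Kstar) < 1)
    (PK Pstar Dstar : Matrix (Fin d) (Fin d) ℝ)
    (hPK : PK.PosDef)
    (hPKeq : PK = Q + Kᵀ * R * K + (A - B * K)ᵀ * PK * (A - B * K))
    (hPstar : Pstar.PosDef)
    (hPstareq : Pstar = Q + Kstarᵀ * R * Kstar + (A - B * Kstar)ᵀ * Pstar * (A - B * Kstar))
    (hDstar : Dstar.PosDef)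
    (hDstareq : Dstar = (D0 + σ ^ 2 • (B * Bᵀ)) + (A - B * Kstar) * Dstar * (A - B * Kstar)ᵀ)
    (hopt : ∀ (K'' : Matrix (Fin k) (Fin d) ℝ) (P'' : Matrix (Fin d) (Fin d) ℝ),
      specRad (A - B * K'') < 1 → P''.PosDef →
      P'' = Q + K''ᵀ * R * K'' + (A - B * K'')ᵀ * P'' * (A - B * K'') →
      (Pstar * (D0 + σ ^ 2 • (B * Bᵀ))).trace + σ ^ 2 * R.trace
        ≤ (P'' * (D0 + σ ^ 2 • (B * Bᵀ))).trace + σ ^ 2 * R.trace) :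
    ((PK * (D0 + σ ^ 2 • (B * Bᵀ))).trace + σ ^ 2 * R.trace)
      - ((Pstar * (D0 + σ ^ 2 • (B * Bᵀ))).trace + σ ^ 2 * R.trace)
      ≤ (sigmaMin R)⁻¹ * spNorm Dstar *
          (((R + Bᵀ * PK * B) * K - Bᵀ * PK * A)ᵀ *
            ((R + Bᵀ * PK * B) * K - Bᵀ * PK * A)).trace := by
  obtain ⟨hs, hRs⟩ := aux_sigmaMin hk hR
  have hN := aux_spNorm hDstar
  generalize sigmaMin R = s at hs hRs ⊢
  generalize spNorm Dstar = N at hN ⊢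
  generalize D0 + σ ^ 2 • (B * Bᵀ) = S at *
  have hRt : Rᵀ = R := by
    simpa [Matrix.conjTranspose_eq_transpose_of_trivial] using hR.1.eq
  have hPt : PKᵀ = PK := by
    simpa [Matrix.conjTranspose_eq_transpose_of_trivial] using hPK.1.eq
  have key : ∀ P : Matrix (Fin d) (Fin d) ℝ, (P * S).trace
      = ((P - (A - B * Kstar)ᵀ * P * (A - B * Kstar)) * Dstar).trace := by
    intro P
    have hS : S = Dstar - (A - B * Kstar) * Dstar * (A - B * Kstar)ᵀ :=
      eq_sub_of_add_eq hDstareq.symm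
    rw [hS]
    generalize A - B * Kstar = M
    rw [Matrix.mul_sub, Matrix.sub_mul, Matrix.trace_sub, Matrix.trace_sub]
    congr 1
    rw [← Matrix.mul_assoc, Matrix.trace_mul_comm]
    simp only [Matrix.mul_assoc]
  have hE : ∃ E, E = (R + Bᵀ * PK * B) * K - Bᵀ * PK * A := ⟨_, rfl⟩
  obtain ⟨E, hE⟩ := hE
  rw [← hE]
  have hst : Pstar - (A - B * Kstar)ᵀ * Pstar * (A - B * Kstar) = Q + Kstarᵀ * R * Kstar :=
    sub_eq_of_eq_add hPstareq
  have hQe : Q = PK - Kᵀ * R * K - (A - B * K)ᵀ * PK * (A - B * K) := by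
    rw [sub_sub]
    apply eq_sub_of_add_eq
    rw [← add_assoc]
    exact hPKeq.symm
  have hdiff : (PK * S).trace - (Pstar * S).trace
      = (((K - Kstar)ᵀ * E + Eᵀ * (K - Kstar)
        - (K - Kstar)ᵀ * (R + Bᵀ * PK * B) * (K - Kstar)) * Dstar).trace := by
    rw [key, key, hst, hQe, ← Matrix.trace_sub, ← Matrix.sub_mul]
    congr 2
    rw [hE]
    simp only [Matrix.transpose_sub, Matrix.transpose_mul, Matrix.transpose_add, hRt, hPt,
      Matrix.transpose_transpose, Matrix.mul_sub, Matrix.sub_mul, Matrix.mul_add, Matrix.add_mul,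
      Matrix.mul_assoc]
    abel
  have hsq : (s⁻¹ • (Eᵀ * E) - ((K - Kstar)ᵀ * E + Eᵀ * (K - Kstar)
        - (K - Kstar)ᵀ * (R + Bᵀ * PK * B) * (K - Kstar))).PosSemidef := by
    have h1 := aux_conj hRs (K - Kstar)
    have h2 := aux_conj (aux_conj hPK.posSemidef B) (K - Kstar)
    have h3 := (aux_conj (Matrix.PosSemidef.one (n := Fin k) (R := ℝ))
      (s • (K - Kstar) - E)).smul (inv_nonneg.mpr hs.le)
    convert (h1.add h2).add h3 using 1
    generalize K - Kstar = Δ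
    simp only [Matrix.transpose_sub, Matrix.transpose_smul, Matrix.mul_sub, Matrix.sub_mul,
      Matrix.mul_add, Matrix.add_mul, Matrix.smul_mul, Matrix.mul_smul, Matrix.mul_one, smul_sub,
      smul_smul, inv_mul_cancel_left₀ hs.ne', inv_mul_cancel₀ hs.ne', one_smul]
    abel
  have h1 := aux_trace_mul_nonneg hsq hDstar.posSemidef
  have h2 := aux_trace_mul_nonneg (aux_conj (Matrix.PosSemidef.one (n := Fin k) (R := ℝ)) E) hN
  rw [Matrix.sub_mul, Matrix.trace_sub, ← hdiff, Matrix.smul_mul, Matrix.trace_smul,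
    smul_eq_mul] at h1
  rw [Matrix.mul_one, Matrix.mul_sub, Matrix.trace_sub, Matrix.mul_smul, Matrix.mul_one,
    Matrix.trace_smul, smul_eq_mul] at h2
  have h3 := mul_nonneg (inv_nonneg.mpr hs.le) h2
  nlinarith
end

section
/- (Gradient domination, lower bound) Let K be stabilizing and let K* be a stabilizing gain minimizing J over all stabilizing gains. Then J(K) − J(K*) ≥ σ_min(D_0) · ‖R + Bᵀ P_K B‖^{-1} · Tr(E_Kᵀ E_K). -/
open Matrix

open Filter Topology

lemma psd_conj {m n : ℕ} {X : Matrix (Fin m) (Fin m) ℝ} (hX : X.PosSemidef)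
    (M : Matrix (Fin m) (Fin n) ℝ) : (Mᵀ * X * M).PosSemidef := by
  have := hX.conjTranspose_mul_mul_same M
  rwa [conjTranspose_eq_transpose_of_trivial] at this

lemma psd_q {n : ℕ} {X : Matrix (Fin n) (Fin n) ℝ} (hX : X.PosSemidef) (v : Fin n → ℝ) :
    0 ≤ v ⬝ᵥ (X *ᵥ v) := by
  simpa using hX.dotProduct_mulVec_nonneg v

lemma psd_of_q {n : ℕ} {X : Matrix (Fin n) (Fin n) ℝ} (hs : Xᵀ = X)
    (h : ∀ v : Fin n → ℝ, 0 ≤ v ⬝ᵥ (X *ᵥ v)) : X.PosSemidef := by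
  refine PosSemidef.of_dotProduct_mulVec_nonneg ?_ ?_
  · rw [Matrix.IsHermitian, conjTranspose_eq_transpose_of_trivial, hs]
  · intro v; simpa using h v

lemma psd_symm {n : ℕ} {X : Matrix (Fin n) (Fin n) ℝ} (hX : X.PosSemidef) : Xᵀ = X := by
  have := hX.isHermitian
  rwa [Matrix.IsHermitian, conjTranspose_eq_transpose_of_trivial] at this

lemma trace_psd_mul {n : ℕ} {X Y : Matrix (Fin n) (Fin n) ℝ} (hX : X.PosSemidef)
    (hY : Y.PosSemidef) : 0 ≤ (X * Y).trace := by
  obtain ⟨C, rfl⟩ : ∃ C : Matrix (Fin n) (Fin n) ℝ, X = Cᴴ * C := by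
    open scoped MatrixOrder in
    exact CStarAlgebra.nonneg_iff_eq_star_mul_self.mp hX.nonneg
  have h := (hY.mul_mul_conjTranspose_same C).trace_nonneg
  rw [Matrix.trace_mul_comm, ← Matrix.mul_assoc] at h
  exact h

lemma psd_lim {n : ℕ} {X : ℕ → Matrix (Fin n) (Fin n) ℝ} {P : Matrix (Fin n) (Fin n) ℝ}
    (h : ∀ i, (X i).PosSemidef) (hl : Tendsto X atTop (𝓝 P)) : P.PosSemidef := by
  refine psd_of_q ?_ ?_
  · have h1 : Tendsto (fun i => (X i)ᵀ) atTop (𝓝 Pᵀ) :=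
      ((continuous_id.matrix_transpose).tendsto P).comp hl
    have h2 : (fun i => (X i)ᵀ) = X := funext fun i => psd_symm (h i)
    rw [h2] at h1
    exact tendsto_nhds_unique h1 hl
  · intro v
    have hc : Continuous (fun Z : Matrix (Fin n) (Fin n) ℝ => v ⬝ᵥ (Z *ᵥ v)) := by fun_prop
    exact ge_of_tendsto' ((hc.tendsto P).comp hl) (fun i => psd_q (h i) v)

lemma mono_lim {n : ℕ} {X : ℕ → Matrix (Fin n) (Fin n) ℝ} {Y : Matrix (Fin n) (Fin n) ℝ}
    (hs : ∀ i, (X i).PosSemidef) (hm : ∀ i, (X (i+1) - X i).PosSemidef)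
    (hb : ∀ i, (Y - X i).PosSemidef) : ∃ P, Tendsto X atTop (𝓝 P) := by
  have hq : ∀ v : Fin n → ℝ, ∃ l, Tendsto (fun i => v ⬝ᵥ (X i *ᵥ v)) atTop (𝓝 l) := by
    intro v
    refine ⟨_, tendsto_atTop_ciSup (monotone_nat_of_le_succ ?_) ⟨v ⬝ᵥ (Y *ᵥ v), ?_⟩⟩
    · intro i
      have := psd_q (hm i) v
      rw [Matrix.sub_mulVec, dotProduct_sub] at this
      linarith
    · rintro _ ⟨i, rfl⟩
      have := psd_q (hb i) v
      rw [Matrix.sub_mulVec, dotProduct_sub] at this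
      simp only; linarith
  choose l hl using hq
  refine ⟨fun a b => (l (Pi.single a 1 + Pi.single b 1) - l (Pi.single a 1)
    - l (Pi.single b 1)) / 2, ?_⟩
  refine tendsto_pi_nhds.2 fun a => tendsto_pi_nhds.2 fun b => ?_
  have := (((hl (Pi.single a 1 + Pi.single b 1)).sub (hl (Pi.single a 1))).sub
    (hl (Pi.single b 1))).div_const 2
  refine this.congr fun i => ?_
  have hsy : X i b a = X i a b := congrFun (congrFun (psd_symm (hs i)) a) b
  simp [Matrix.mulVec_add, add_dotProduct, dotProduct_add, hsy]
  ring

lemma lyap_exists {n : ℕ} {M W Y : Matrix (Fin n) (Fin n) ℝ} (hW : W.PosDef)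
    (hY : Y.PosSemidef) (h : (Y - (W + Mᵀ * Y * M)).PosSemidef) :
    ∃ P : Matrix (Fin n) (Fin n) ℝ, P.PosDef ∧ P = W + Mᵀ * P * M ∧ (Y - P).PosSemidef := by
  let L : Matrix (Fin n) (Fin n) ℝ → Matrix (Fin n) (Fin n) ℝ := fun Z => W + Mᵀ * Z * M
  have hL : ∀ Z Z', L Z - L Z' = Mᵀ * (Z - Z') * M := by
    intro Z Z'; simp only [L, Matrix.mul_sub, Matrix.sub_mul]; abel
  let X : ℕ → Matrix (Fin n) (Fin n) ℝ := fun i => L^[i] 0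
  have hX : ∀ i, X (i+1) = L (X i) := fun i => Function.iterate_succ_apply' L i 0
  have hs : ∀ i, (X i).PosSemidef := by
    intro i
    induction i with
    | zero => exact PosSemidef.zero
    | succ i ih => rw [hX]; exact hW.posSemidef.add (psd_conj ih M)
  have hm : ∀ i, (X (i+1) - X i).PosSemidef := by
    intro i
    induction i with
    | zero => simpa [X, L] using hW.posSemidef
    | succ i ih => rw [hX (i+1), hX i, hL, ← hX]; exact psd_conj ih M
  have hb : ∀ i, (Y - X i).PosSemidef := by
    intro i
    induction i with
    | zero => simpa [X] using hY
    | succ i ih =>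
      have : Y - X (i+1) = (Y - L Y) + Mᵀ * (Y - X i) * M := by
        rw [hX, ← hL]; abel
      rw [this]; exact h.add (psd_conj ih M)
  obtain ⟨P, hP⟩ := mono_lim hs hm hb
  have hPs := psd_lim hs hP
  have hc : Continuous L := by fun_prop
  have heq : P = L P := by
    refine tendsto_nhds_unique ((tendsto_add_atTop_iff_nat 1).2 hP) ?_
    have := (hc.tendsto P).comp hP
    exact this.congr fun i => (hX i).symm
  refine ⟨P, ?_, heq, psd_lim hb (tendsto_const_nhds.sub hP)⟩
  rw [heq]; exact hW.add_posSemidef (psd_conj hPs M)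

lemma stab {n : ℕ} {M P : Matrix (Fin n) (Fin n) ℝ} (hP : P.PosDef)
    (h : (P - Mᵀ * P * M).PosDef) : specRad M < 1 := by
  unfold specRad
  rcases Set.eq_empty_or_nonempty ((fun z : ℂ => ‖z‖) '' spectrum ℂ (M.map Complex.ofReal))
    with he | hne
  · rw [he]; simp
  rw [Set.Finite.csSup_lt_iff ((Matrix.finite_spectrum _).image _) hne]
  rintro _ ⟨z, hz, rfl⟩
  rw [← Matrix.spectrum_toLin', ← Module.End.hasEigenvalue_iff_mem_spectrum] at hz
  obtain ⟨v, hv⟩ := hz.exists_hasEigenvector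
  have hv1 : M.map Complex.ofReal *ᵥ v = z • v := by simpa using hv.apply_eq_smul
  have hv0 := hv.2
  let x : Fin n → ℝ := fun i => (v i).re
  let y : Fin n → ℝ := fun i => (v i).im
  have hx : M *ᵥ x = z.re • x - z.im • y := by
    ext i
    have := congrArg Complex.re (congrFun hv1 i)
    simpa [Matrix.mulVec, dotProduct, x, y] using this
  have hy : M *ᵥ y = z.im • x + z.re • y := by
    ext i
    have := congrArg Complex.im (congrFun hv1 i)
    simp [Matrix.mulVec, dotProduct] at this
    simp [Matrix.mulVec, dotProduct, x, y, this]; ring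
  have hxy : x ≠ 0 ∨ y ≠ 0 := by
    by_contra hcon
    push Not at hcon
    apply hv0
    ext i
    exact Complex.ext (congrFun hcon.1 i) (congrFun hcon.2 i)
  let q : (Fin n → ℝ) → ℝ := fun u => u ⬝ᵥ (P *ᵥ u)
  have hq0 : ∀ u, 0 ≤ q u := fun u => psd_q hP.posSemidef u
  have e : ∀ u, u ⬝ᵥ ((P - Mᵀ * P * M) *ᵥ u) = q u - q (M *ᵥ u) := by
    intro u
    simp only [q]
    rw [Matrix.sub_mulVec, dotProduct_sub, ← Matrix.mulVec_mulVec, ← Matrix.mulVec_mulVec,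
      Matrix.dotProduct_mulVec u Mᵀ, Matrix.vecMul_transpose]
  have h1 : ∀ u, q (M *ᵥ u) ≤ q u := by
    intro u; have := psd_q h.posSemidef u; rw [e] at this; linarith
  have h2 : ∀ u, u ≠ 0 → q (M *ᵥ u) < q u := by
    intro u hu; have := h.dotProduct_mulVec_pos hu
    simp only [star_trivial] at this
    rw [e] at this; linarith
  have hlt : q (M *ᵥ x) + q (M *ᵥ y) < q x + q y := by
    rcases hxy with hu | hu
    · exact add_lt_add_of_lt_of_le (h2 _ hu) (h1 _)
    · exact add_lt_add_of_le_of_lt (h1 _) (h2 _ hu)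
  have hid : q (M *ᵥ x) + q (M *ᵥ y) = (z.re^2 + z.im^2) * (q x + q y) := by
    rw [hx, hy]
    simp only [q, Matrix.mulVec_add, Matrix.mulVec_sub, Matrix.mulVec_smul, add_dotProduct,
      sub_dotProduct, dotProduct_add, dotProduct_sub, smul_dotProduct, dotProduct_smul,
      smul_eq_mul]
    ring
  have hn : ‖z‖^2 = z.re^2 + z.im^2 := by rw [Complex.sq_norm, Complex.normSq_apply]; ring
  rw [hid, ← hn] at hlt
  have hpos : 0 ≤ q x + q y := add_nonneg (hq0 _) (hq0 _)
  by_contra hge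
  push Not at hge
  have : 1 ≤ ‖z‖^2 := by nlinarith
  nlinarith

lemma sigmaMin_psd {n : ℕ} {D : Matrix (Fin n) (Fin n) ℝ} (hD : D.PosDef) :
    (D - sigmaMin D • (1 : Matrix (Fin n) (Fin n) ℝ)).PosSemidef := by
  have hDs := psd_symm hD.posSemidef
  have hsp := (posSemidef_iff_isHermitian_and_spectrum_nonneg.1 hD.posSemidef).2
  rw [posSemidef_iff_isHermitian_and_spectrum_nonneg]
  constructor
  · rw [Matrix.IsHermitian, conjTranspose_eq_transpose_of_trivial]; simp [hDs]
  intro x hx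
  have hx' : x + sigmaMin D ∈ spectrum ℝ D := by
    rw [spectrum.mem_iff] at hx ⊢
    convert hx using 2
    rw [map_add, Algebra.algebraMap_eq_smul_one (sigmaMin D)]; abel
  have h0 : 0 ≤ x + sigmaMin D := hsp hx'
  have h2 := spectrum.pow_mem_pow D 2 hx'
  have h3 : sigmaMin D ≤ x + sigmaMin D := by
    conv_lhs => rw [sigmaMin, hDs, ← pow_two]
    rw [Real.sqrt_le_left h0]
    exact csInf_le (Matrix.finite_spectrum _).bddBelow h2
  simpa using h3

lemma spNorm_q {n : ℕ} (S : Matrix (Fin n) (Fin n) ℝ) (w : Fin n → ℝ) :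
    w ⬝ᵥ (S *ᵥ w) ≤ spNorm S * (w ⬝ᵥ w) := by
  have h1 := (LinearMap.toContinuousLinearMap (Matrix.toEuclideanLin S)).le_opNorm
    (WithLp.toLp 2 w)
  have h2 := real_inner_le_norm (LinearMap.toContinuousLinearMap (Matrix.toEuclideanLin S)
    (WithLp.toLp 2 w)) (WithLp.toLp 2 w)
  have h3 : inner ℝ (LinearMap.toContinuousLinearMap (Matrix.toEuclideanLin S)
    (WithLp.toLp 2 w)) (WithLp.toLp 2 w) = w ⬝ᵥ (S *ᵥ w) := by
    simp [EuclideanSpace.inner_eq_star_dotProduct]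
  have h4 : ‖WithLp.toLp 2 w‖ * ‖WithLp.toLp 2 w‖ = w ⬝ᵥ w := by
    rw [← real_inner_self_eq_norm_mul_norm, EuclideanSpace.inner_eq_star_dotProduct]; simp
  rw [h3] at h2
  rw [← h4, ← mul_assoc]
  exact h2.trans (mul_le_mul_of_nonneg_right h1 (norm_nonneg _))

lemma inv_psd {n : ℕ} {S : Matrix (Fin n) (Fin n) ℝ} (hS : S.PosDef) :
    (S⁻¹ - (spNorm S)⁻¹ • (1 : Matrix (Fin n) (Fin n) ℝ)).PosSemidef := by
  have hSi := hS.inv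
  have hu : IsUnit S.det := (Matrix.isUnit_iff_isUnit_det S).1 hS.isUnit
  refine psd_of_q ?_ ?_
  · simp [psd_symm hSi.posSemidef]
  intro w
  have hnn : 0 ≤ spNorm S := norm_nonneg _
  rcases eq_or_lt_of_le hnn with h0 | h0
  · rw [← h0]; simpa using psd_q hSi.posSemidef w
  set c := spNorm S
  have h1 := psd_q hS.posSemidef (S⁻¹ *ᵥ w - c⁻¹ • w)
  have h2 := spNorm_q S w
  have hw : S *ᵥ (S⁻¹ *ᵥ w) = w := by
    rw [Matrix.mulVec_mulVec, Matrix.mul_nonsing_inv _ hu, Matrix.one_mulVec]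
  have hw2 : (S⁻¹ *ᵥ w) ⬝ᵥ (S *ᵥ w) = w ⬝ᵥ w := by
    rw [Matrix.dotProduct_mulVec, ← Matrix.mulVec_transpose, psd_symm hS.posSemidef, hw]
  have hw3 : (S⁻¹ *ᵥ w) ⬝ᵥ w = w ⬝ᵥ (S⁻¹ *ᵥ w) := dotProduct_comm _ _
  simp only [Matrix.mulVec_sub, Matrix.mulVec_smul, sub_dotProduct, dotProduct_sub,
    smul_dotProduct, dotProduct_smul, smul_eq_mul, hw, hw2, hw3] at h1
  simp only [Matrix.sub_mulVec, Matrix.smul_mulVec, Matrix.one_mulVec, dotProduct_sub,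
    dotProduct_smul, smul_eq_mul]
  have h3 : c⁻¹ * (c⁻¹ * (w ⬝ᵥ (S *ᵥ w))) ≤ c⁻¹ * (w ⬝ᵥ w) := by
    refine mul_le_mul_of_nonneg_left ?_ (by positivity)
    rw [inv_mul_le_iff₀ h0]; exact h2
  linarith

/-- Gradient domination (lower bound): for stabilizing `K` and an optimal stabilizing `K*`,
`J(K) − J(K*) ≥ σ_min(D₀) ‖R + Bᵀ P_K B‖⁻¹ Tr(E_Kᵀ E_K)`. -/
theorem gradient_domination_lower {d k : ℕ} (hd : 1 ≤ d) (hk : 1 ≤ k)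
    (A : Matrix (Fin d) (Fin d) ℝ) (B : Matrix (Fin d) (Fin k) ℝ)
    (Q : Matrix (Fin d) (Fin d) ℝ) (R : Matrix (Fin k) (Fin k) ℝ)
    (D0 : Matrix (Fin d) (Fin d) ℝ) (σ : ℝ) (hσ : 0 < σ)
    (hQ : Q.PosDef) (hR : R.PosDef) (hD0 : D0.PosDef)
    (K Kstar : Matrix (Fin k) (Fin d) ℝ)
    (hK : specRad (A - B * K) < 1) (hKstar : specRad (A - B * Kstar) < 1)
    (PK Pstar Dstar : Matrix (Fin d) (Fin d) ℝ)
    (hPK : PK.PosDef)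
    (hPKeq : PK = Q + Kᵀ * R * K + (A - B * K)ᵀ * PK * (A - B * K))
    (hPstar : Pstar.PosDef)
    (hPstareq : Pstar = Q + Kstarᵀ * R * Kstar + (A - B * Kstar)ᵀ * Pstar * (A - B * Kstar))
    (hDstar : Dstar.PosDef)
    (hDstareq : Dstar = (D0 + σ ^ 2 • (B * Bᵀ)) + (A - B * Kstar) * Dstar * (A - B * Kstar)ᵀ)
    (hopt : ∀ (K'' : Matrix (Fin k) (Fin d) ℝ) (P'' : Matrix (Fin d) (Fin d) ℝ),
      specRad (A - B * K'') < 1 → P''.PosDef →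
      P'' = Q + K''ᵀ * R * K'' + (A - B * K'')ᵀ * P'' * (A - B * K'') →
      (Pstar * (D0 + σ ^ 2 • (B * Bᵀ))).trace + σ ^ 2 * R.trace
        ≤ (P'' * (D0 + σ ^ 2 • (B * Bᵀ))).trace + σ ^ 2 * R.trace) :
    ((PK * (D0 + σ ^ 2 • (B * Bᵀ))).trace + σ ^ 2 * R.trace)
      - ((Pstar * (D0 + σ ^ 2 • (B * Bᵀ))).trace + σ ^ 2 * R.trace)
      ≥ sigmaMin D0 * (spNorm (R + Bᵀ * PK * B))⁻¹ *
          (((R + Bᵀ * PK * B) * K - Bᵀ * PK * A)ᵀ *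
            ((R + Bᵀ * PK * B) * K - Bᵀ * PK * A)).trace := by
  set S := R + Bᵀ * PK * B with hSdef
  set E := S * K - Bᵀ * PK * A with hE
  have hSpd : S.PosDef := hR.add_posSemidef (psd_conj hPK.posSemidef B)
  have hu : IsUnit S.det := (Matrix.isUnit_iff_isUnit_det S).1 hSpd.isUnit
  have hSs : Sᵀ = S := psd_symm hSpd.posSemidef
  have hPs : PKᵀ = PK := psd_symm hPK.posSemidef
  have hSis : (S⁻¹)ᵀ = S⁻¹ := psd_symm hSpd.inv.posSemidef
  let F := S⁻¹ * E
  have hF : S * F = E := by simp only [F]; rw [Matrix.mul_nonsing_inv_cancel_left _ _ hu]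
  let K' := K - F
  let M := A - B * K'
  let W := Q + K'ᵀ * R * K'
  let G := Eᵀ * S⁻¹ * E
  have hG : G.PosSemidef := psd_conj hSpd.inv.posSemidef E
  have hGF : G = Fᵀ * S * F := by
    simp only [G, Matrix.mul_assoc, hF]
    simp only [F, Matrix.transpose_mul, hSis, Matrix.mul_assoc]
  have hW : W.PosDef := hQ.add_posSemidef (psd_conj hR.posSemidef K')
  have key : PK = W + Mᵀ * PK * M + G := by
    have e1 : Fᵀ * E = G := by rw [hGF, ← hF, Matrix.mul_assoc]
    have e2 : Eᵀ * F = G := by rw [hGF, ← hF, Matrix.transpose_mul, hSs]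
    have e3 : W + Mᵀ * PK * M = (Q + Kᵀ * R * K + (A - B * K)ᵀ * PK * (A - B * K))
        - Fᵀ * E - Eᵀ * F + Fᵀ * S * F := by
      rw [hE, hSdef]
      simp only [W, M, K', Matrix.transpose_sub, Matrix.transpose_add, Matrix.transpose_mul,
        Matrix.transpose_transpose, hPs, psd_symm hR.posSemidef, Matrix.mul_sub, Matrix.sub_mul,
        Matrix.mul_add, Matrix.add_mul, Matrix.mul_assoc]
      abel
    rw [e3, ← hPKeq, e1, e2, ← hGF]; abel
  have hMP : PK - Mᵀ * PK * M = W + G := by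
    nth_rewrite 1 [key]; abel
  have hst : specRad M < 1 := stab hPK (by rw [hMP]; exact hW.add_posSemidef hG)
  have hY1 : PK - G = W + Mᵀ * PK * M := by
    nth_rewrite 1 [key]; abel
  have hY : (PK - G).PosSemidef := by
    rw [hY1]; exact hW.posSemidef.add (psd_conj hPK.posSemidef M)
  obtain ⟨P, hP, hPeq, hPle⟩ := lyap_exists (M := M) hW hY (by
    have : PK - G - (W + Mᵀ * (PK - G) * M) = Mᵀ * G * M := by
      rw [Matrix.mul_sub Mᵀ PK G, Matrix.sub_mul (Mᵀ * PK) (Mᵀ * G) M, hY1]; abel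
    rw [this]; exact psd_conj hG M)
  have ho := hopt K' P hst hP hPeq
  set Ds := D0 + σ ^ 2 • (B * Bᵀ) with hDs
  have hBB : (σ ^ 2 • (B * Bᵀ)).PosSemidef := by
    have := posSemidef_self_mul_conjTranspose B
    rw [conjTranspose_eq_transpose_of_trivial] at this
    exact this.smul (sq_nonneg σ)
  have hDsp : Ds.PosSemidef := hD0.posSemidef.add hBB
  have t1 := trace_psd_mul hPle hDsp
  have t2 := trace_psd_mul hG hBB
  have t3 := trace_psd_mul hG (sigmaMin_psd hD0)
  have t4 := (psd_conj (inv_psd hSpd) E).trace_nonneg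
  have t5 : (G * Ds).trace = (G * D0).trace + (G * (σ ^ 2 • (B * Bᵀ))).trace := by
    rw [hDs, Matrix.mul_add, Matrix.trace_add]
  simp only [Matrix.sub_mul, Matrix.mul_sub, Matrix.trace_sub, Matrix.mul_smul, Matrix.smul_mul,
    Matrix.trace_smul, Matrix.mul_one, smul_eq_mul] at t1 t3 t4
  have t6 : 0 ≤ sigmaMin D0 := Real.sqrt_nonneg _
  have t7 := mul_le_mul_of_nonneg_left (sub_nonneg.1 t4) t6
  have t8 : (Eᵀ * S⁻¹ * E).trace = G.trace := rfl
  rw [t8] at t7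
  rw [mul_assoc]
  linarith
end
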